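/- For every λ⊕-term M and every resource term s in the support 𝒯(M) of its Taylor expansion, the coefficient of s in T(M) equals 1/m(s), where m is the multiplicity coefficient. -/

import Mathlib

set_option maxHeartbeats 1000000

/-! ### Rigid resource terms -/

/-- Rigid resource terms (de Bruijn indices for variables):
`a ::= x | λ.a | ⟨a⟩b⃗ | a⊕• | •⊕a` where argument lists are ordered. -/
inductive Rt : Type
  | var : ℕ → Rt
  | lam : Rt → Rt
  | app : Rt → List Rt → Rt
  | inl : Rt → Rt
  | inr : Rt → Rt
deriving Inhabited

/-- Rigid resource expressions: terms or (rigid) monomials. -/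
abbrev REx : Type := Rt ⊕ List Rt

/-! ### Isomorphism of rigid expressions -/

mutual
  /-- Two rigid terms are isomorphic (`≅`) when they differ only by
  permutations of argument lists. -/
  inductive IsoT : Rt → Rt → Prop
    | var (x : ℕ) : IsoT (.var x) (.var x)
    | lam {a a'} : IsoT a a' → IsoT (.lam a) (.lam a')
    | inl {a a'} : IsoT a a' → IsoT (.inl a) (.inl a')
    | inr {a a'} : IsoT a a' → IsoT (.inr a) (.inr a')
    | app {c c' : Rt} {ds ds' : List Rt} :
        IsoT c c' → IsoM ds ds' → IsoT (.app c ds) (.app c' ds')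
  /-- Isomorphism of rigid monomials: a permutation `σ` together with
  isomorphisms `aᵢ ≅ a'_{σ(i)}`. -/
  inductive IsoM : List Rt → List Rt → Prop
    | mk (as as' : List Rt) (h : as'.length = as.length) (σ : Equiv.Perm (Fin as.length))
        (H : ∀ i : Fin as.length, IsoT (as.get i) (as'.get ((σ i).cast h.symm))) :
        IsoM as as'
end

/-! ### Resource expressions as quotients of rigid expressions -/

/-- Resource terms: rigid terms up to permutations of arguments, i.e. terms
whose argument lists are multisets. -/
def ResTerm : Type := Quot IsoT

instance : Inhabited ResTerm := ⟨Quot.mk _ (.var 0)⟩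

/-- The resource term represented by a rigid term (`r ◁ |r|`). -/
def rmk : Rt → ResTerm := Quot.mk IsoT

/-- A choice of rigid representation of a resource term. -/
noncomputable def rout : ResTerm → Rt := Quot.out

/-- The resource monomial (multiset) represented by a rigid monomial (list). -/
def toMul (bs : List Rt) : Multiset ResTerm := ↑(bs.map rmk)

/-- Resource expressions: terms or monomials (finite multisets of terms). -/
abbrev ResExpr : Type := ResTerm ⊕ Multiset ResTerm

/-- The resource expression represented by a rigid expression. -/
def toQ : REx → ResExpr := Sum.map rmk toMul

/-- A choice of rigid representation of a resource expression. -/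
noncomputable def outE : ResExpr → REx :=
  Sum.map rout (fun m => m.toList.map rout)

/-- Variable as a resource term. -/
def qVar (x : ℕ) : ResTerm := rmk (.var x)

/-- Abstraction on resource terms. -/
noncomputable def qLam (s : ResTerm) : ResTerm := rmk (.lam (rout s))

/-- Left injection `(-) ⊕ •` on resource terms. -/
noncomputable def qInl (s : ResTerm) : ResTerm := rmk (.inl (rout s))

/-- Right injection `• ⊕ (-)` on resource terms. -/
noncomputable def qInr (s : ResTerm) : ResTerm := rmk (.inr (rout s))

/-- Application `⟨s⟩t̄` of a resource term to a resource monomial. -/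
noncomputable def qApp (s : ResTerm) (t : Multiset ResTerm) : ResTerm :=
  rmk (.app (rout s) (t.toList.map rout))

/-! ### The nondeterministic λ⊕-calculus (de Bruijn indices) -/

/-- λ⊕-terms: `M ::= x | λx.M | M N | M ⊕ N`. -/
inductive Lam : Type
  | var : ℕ → Lam
  | lam : Lam → Lam
  | app : Lam → Lam → Lam
  | oplus : Lam → Lam → Lam
deriving Inhabited

namespace Lam

/-- Shift free de Bruijn indices `≥ c` up by one. -/
def shift (c : ℕ) : Lam → Lam
  | .var n => .var (if n < c then n else n + 1)
  | .lam M => .lam (M.shift (c + 1))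
  | .app M N => .app (M.shift c) (N.shift c)
  | .oplus M N => .oplus (M.shift c) (N.shift c)

/-- Capture-avoiding substitution `M[N/x]` (de Bruijn). -/
def subst : Lam → ℕ → Lam → Lam
  | .var n, x, N => if n = x then N else if x < n then .var (n - 1) else .var n
  | .lam M, x, N => .lam (M.subst (x + 1) (N.shift 0))
  | .app M P, x, N => .app (M.subst x N) (P.subst x N)
  | .oplus M P, x, N => .oplus (M.subst x N) (P.subst x N)

/-- Does the head of the application spine consist of a variable? -/
def headVar : Lam → Bool
  | .var _ => true
  | .app M _ => M.headVar
  | _ => false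

/-- The hereditary head reduction strategy `L` on λ⊕-terms. -/
def headL : Lam → Lam
  | .var x => .var x
  | .oplus M N => .oplus M.headL N.headL
  | .lam (.oplus P Q) => .oplus (.lam P) (.lam Q)
  | .lam M => .lam M.headL
  | .app (.lam P) N => P.subst 0 N
  | .app (.oplus P Q) N => .oplus (.app P N) (.app Q N)
  | .app M N => if M.headVar then .app M.headL N.headL else .app M.headL N

end Lam

/-! ### Promotion -/

/-- Promotion `S^! = ∑_{n≥0} (1/n!) Sⁿ` of a vector of resource terms, where
`Sⁿ = [S,…,S]` (`n` copies) is the sum over all `n`-tuples; its coefficient on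
a multiset `m` of cardinality `n` is `(1/n!) · #{enumerations of m} · ∏_{t ∈ m} S t`. -/
noncomputable def prom (S : ResTerm → ℚ≥0) (m : Multiset ResTerm) : ℚ≥0 :=
  (Nat.card {l : List ResTerm // (↑l : Multiset ResTerm) = m} : ℚ≥0) /
      (Nat.factorial (Multiset.card m)) * (m.map S).prod

/-! ### Taylor expansion -/

/-- Coefficients of the Taylor expansion `T(M)`, computed on a rigid
representative: `T(x) = x`, `T(λx.N) = λx.T(N)`, `T(PQ) = ⟨T(P)⟩(T(Q))^!`,
`T(P⊕Q) = (T(P)⊕•) + (•⊕T(Q))`. -/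
noncomputable def TCrig : Lam → Rt → ℚ≥0
  | .var x, .var y => if y = x then 1 else 0
  | .lam M, .lam a => TCrig M a
  | .app P Q, .app a bs => TCrig P a * prom (fun s => TCrig Q (rout s)) (toMul bs)
  | .oplus P _, .inl a => TCrig P a
  | .oplus _ Q, .inr a => TCrig Q a
  | _, _ => 0
termination_by M _ => sizeOf M

/-- The Taylor expansion of a λ⊕-term, as a possibly infinite linear
combination of resource terms with nonnegative rational coefficients:
`taylor M s` is the coefficient of `s` in `T(M)`. -/
noncomputable def taylor (M : Lam) (s : ResTerm) : ℚ≥0 := TCrig M (rout s)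

/-- The support `𝒯(M)` of the Taylor expansion of `M`. -/
noncomputable def taysup (M : Lam) : Set ResTerm := {s | taylor M s ≠ 0}

/-! ### Multiplicity coefficients -/

/-- The factor `∏ᵢ kᵢ!` of the multiplicity of a rigid monomial, where the `kᵢ`
are the multiplicities of the pairwise distinct resource terms represented in it. -/
noncomputable def stabFac (bs : List Rt) : ℕ :=
  letI := Classical.decEq ResTerm
  (toMul bs).toFinset.prod fun t => Nat.factorial ((toMul bs).count t)

/-- Multiplicity coefficient of a rigid term; for a monomial representing
`[t₁]^{k₁}·…·[tₚ]^{kₚ}` (the `tᵢ` pairwise distinct) the factor contributed is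
`∏ᵢ kᵢ! · m(tᵢ)^{kᵢ} = (∏ᵢ kᵢ!) · ∏_{b ∈ b⃗} m(b)`. -/
noncomputable def mRig : Rt → ℕ
  | .var _ => 1
  | .lam a => mRig a
  | .inl a => mRig a
  | .inr a => mRig a
  | .app c ds => mRig c * (stabFac ds * (ds.attach.map fun e => mRig e.1).prod)
termination_by r => sizeOf r
decreasing_by
  all_goals simp_wf
  all_goals try omega
  all_goals (have := List.sizeOf_lt_of_mem e.2; omega)

/-- Multiplicity coefficient `m(s)` of a resource term. -/
noncomputable def mT (s : ResTerm) : ℕ := mRig (rout s)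

/-- Multiplicity coefficient `m(t̄) = ∏ᵢ kᵢ! · m(tᵢ)^{kᵢ}` of a resource
monomial `[t₁]^{k₁}·…·[tₚ]^{kₚ}` with the `tᵢ` pairwise distinct. -/
noncomputable def mMon (m : Multiset ResTerm) : ℕ :=
  letI := Classical.decEq ResTerm
  m.toFinset.prod fun t => Nat.factorial (m.count t) * (mT t) ^ (m.count t)

/-- Multiplicity coefficient of a resource expression. -/
noncomputable def mE : ResExpr → ℕ := Sum.elim mT mMon

/-! ### Enumerations of a multiset -/

section Enumerations

variable {α : Type*} [DecidableEq α]

theorem Multiset.finite_enumerations (m : Multiset α) :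
    Finite {l : List α // (↑l : Multiset α) = m} := by
  induction m using Quotient.inductionOn with
  | h l₀ =>
    refine Set.Finite.subset l₀.permutations.toFinset.finite_toSet fun l hl => ?_
    simpa using Multiset.coe_eq_coe.1 hl

/-- A nonempty enumeration of `m` is a choice of a head in `m` and an enumeration of the rest. -/
def Multiset.enumerationsEquiv (m : Multiset α) (hm : m ≠ 0) :
    {l : List α // (↑l : Multiset α) = m} ≃
      Σ t : m.toFinset, {l : List α // (↑l : Multiset α) = m.erase t} where
  toFun
    | ⟨[], h⟩ => absurd h.symm hm
    | ⟨t :: l, h⟩ => ⟨⟨t, by simp [← h]⟩, l, by simp [← h]⟩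
  invFun p := ⟨p.1.1 :: p.2.1, by
    rw [← Multiset.cons_coe, p.2.2]
    exact Multiset.cons_erase (Multiset.mem_toFinset.1 p.1.2)⟩
  left_inv
    | ⟨[], h⟩ => absurd h.symm hm
    | ⟨_ :: _, _⟩ => rfl
  right_inv _ := rfl

theorem Multiset.prod_factorial_count_cons (a : α) (m : Multiset α) :
    ∏ t ∈ (a ::ₘ m).toFinset, ((a ::ₘ m).count t).factorial =
      (m.count a + 1) * ∏ t ∈ m.toFinset, (m.count t).factorial := by
  have h : ∏ t ∈ m.toFinset, (m.count t).factorial =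
      ∏ t ∈ (a ::ₘ m).toFinset, (m.count t).factorial := by
    refine Finset.prod_subset (by simp) fun t _ ht => ?_
    rw [Multiset.count_eq_zero_of_notMem (by simpa using ht), Nat.factorial_zero]
  have ha : a ∈ (a ::ₘ m).toFinset := by simp
  rw [h, ← Finset.mul_prod_erase _ _ ha, ← Finset.mul_prod_erase _ _ ha, ← mul_assoc,
    Multiset.count_cons_self, Nat.factorial_succ]
  congr 1
  refine Finset.prod_congr rfl fun t ht => ?_
  rw [Multiset.count_cons_of_ne (Finset.ne_of_mem_erase ht)]

theorem Multiset.card_enumerations_mul_prod_factorial_count (m : Multiset α) :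
    Nat.card {l : List α // (↑l : Multiset α) = m} * ∏ t ∈ m.toFinset, (m.count t).factorial =
      (Multiset.card m).factorial := by
  induction hn : Multiset.card m generalizing m with
  | zero =>
    obtain rfl := Multiset.card_eq_zero.1 hn
    simp
  | succ n ih =>
    have hm : m ≠ 0 := by rintro rfl; simp at hn
    have := fun t : m.toFinset => Multiset.finite_enumerations (m.erase t.1)
    rw [Nat.card_congr (m.enumerationsEquiv hm), Nat.card_sigma, Finset.sum_mul]
    have step (t : m.toFinset) :
        Nat.card {l : List α // (↑l : Multiset α) = m.erase t} *
          ∏ t ∈ m.toFinset, (m.count t).factorial = m.count t.1 * n.factorial := by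
      obtain ⟨t, ht⟩ := t
      obtain ⟨m, rfl⟩ := Multiset.exists_cons_of_mem (Multiset.mem_toFinset.1 ht)
      rw [Multiset.prod_factorial_count_cons, ← ih m (by simpa using hn)]
      simp only [Multiset.erase_cons_head, Multiset.count_cons_self]
      ring
    rw [Finset.sum_congr rfl fun t _ => step t, ← Finset.sum_mul,
      Finset.sum_coe_sort m.toFinset (fun t => m.count t), Multiset.toFinset_sum_count_eq, hn,
      Nat.factorial_succ]

end Enumerations

/-! ### Invariance of the multiplicity under isomorphism -/

theorem mRig_app (c : Rt) (ds : List Rt) :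
    mRig (.app c ds) = mRig c * (stabFac ds * (ds.map mRig).prod) := by
  rw [mRig, List.attach_map_val (f := mRig)]

theorem List.map_eq_map_comp_perm_perm {α β : Type*} {as as' : List α} (f : α → β)
    (h : as'.length = as.length) (σ : Equiv.Perm (Fin as.length))
    (H : ∀ i : Fin as.length, f (as.get i) = f (as'.get ((σ i).cast h.symm))) :
    (as.map f).Perm (as'.map f) := by
  have h₁ : as.map f = List.ofFn ((fun i => f (as'.get (i.cast h.symm))) ∘ σ) := by
    refine List.ext_getElem (by simp) fun i hi _ => ?_
    simpa using H ⟨i, by simpa using hi⟩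
  have h₂ : as'.map f = List.ofFn (fun i : Fin as.length => f (as'.get (i.cast h.symm))) :=
    List.ext_getElem (by simp [h]) fun i _ _ => by simp
  rw [h₁, h₂]
  exact σ.ofFn_comp_perm _

theorem IsoT.mRig_eq {a a' : Rt} (h : IsoT a a') : mRig a = mRig a' := by
  induction h using IsoT.rec
    (motive_2 := fun as as' _ => toMul as = toMul as' ∧ (as.map mRig).prod = (as'.map mRig).prod)
    with
  | var => rfl
  | lam _ ih => simpa only [mRig] using ih
  | inl _ ih => simpa only [mRig] using ih
  | inr _ ih => simpa only [mRig] using ih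
  | app _ _ ih ih' => simp only [mRig_app, stabFac, ih, ih'.1, ih'.2]
  | mk as as' h σ H ih =>
    exact ⟨Multiset.coe_eq_coe.2
        (List.map_eq_map_comp_perm_perm rmk h σ fun i => Quot.sound (H i)),
      (List.map_eq_map_comp_perm_perm mRig h σ ih).prod_eq⟩

theorem mRig_rout_rmk (b : Rt) : mRig (rout (rmk b)) = mRig b :=
  congrArg (Quot.lift mRig fun _ _ => IsoT.mRig_eq) (Quot.out_eq (rmk b))

/-! ### Coefficients of the Taylor expansion -/

theorem prom_toMul (S : ResTerm → ℚ≥0) (bs : List Rt) :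
    prom S (toMul bs) = (stabFac bs : ℚ≥0)⁻¹ * (bs.map fun b => S (rmk b)).prod := by
  classical
  have hN := Multiset.card_enumerations_mul_prod_factorial_count (toMul bs)
  have hs : stabFac bs = ∏ t ∈ (toMul bs).toFinset, ((toMul bs).count t).factorial := by
    unfold stabFac
    congr!
  have hs₀ : (stabFac bs : ℚ≥0) ≠ 0 := by
    rw [hs]
    exact_mod_cast Finset.prod_ne_zero_iff.2 fun t _ => Nat.factorial_ne_zero _
  have hf : ((Multiset.card (toMul bs)).factorial : ℚ≥0) ≠ 0 := by
    exact_mod_cast Nat.factorial_ne_zero _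
  rw [← hs] at hN
  have hp : ((toMul bs).map S).prod = (bs.map fun b => S (rmk b)).prod := by
    simp [toMul, Function.comp_def]
  rw [prom, hp]
  congr 1
  rw [div_eq_iff hf, ← hN, Nat.cast_mul, mul_comm, mul_assoc, mul_inv_cancel₀ hs₀, mul_one]

theorem TCrig_eq_inv_mRig (M : Lam) (r : Rt) (h : TCrig M r ≠ 0) :
    TCrig M r = (mRig r : ℚ≥0)⁻¹ := by
  induction M generalizing r with
  | var x =>
    cases r <;> simp_all [TCrig, mRig]
  | lam M ih =>
    cases r with
    | lam a => simp only [TCrig, mRig] at h ⊢; exact ih a h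
    | _ => simp [TCrig] at h
  | oplus P Q ihP ihQ =>
    cases r with
    | inl a => simp only [TCrig, mRig] at h ⊢; exact ihP a h
    | inr a => simp only [TCrig, mRig] at h ⊢; exact ihQ a h
    | _ => simp [TCrig] at h
  | app P Q ihP ihQ =>
    cases r with
    | app c bs =>
      rw [TCrig, prom_toMul] at h ⊢
      have hbs := right_ne_zero_of_mul (right_ne_zero_of_mul h)
      have hmap : (bs.map fun b => TCrig Q (rout (rmk b))) =
          bs.map fun b => (mRig b : ℚ≥0)⁻¹ := by
        refine List.map_congr_left fun b hb => ?_
        rw [ihQ _ fun h₀ => hbs (List.prod_eq_zero (List.mem_map.2 ⟨b, hb, h₀⟩)), mRig_rout_rmk]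
      rw [hmap, ihP c (left_ne_zero_of_mul h), mRig_app]
      push_cast
      rw [mul_inv, mul_inv, List.prod_inv, List.map_map, List.map_map]
      rfl
    | _ => simp [TCrig] at h

/-! ### STATEMENT 1:
For every λ⊕-term `M` and every resource term `s` in the support `𝒯(M)` of its
Taylor expansion, the coefficient of `s` in `T(M)` equals `1/m(s)`. -/
theorem taylor_coeff_eq_inv_multiplicity (M : Lam) (s : ResTerm) (hs : s ∈ taysup M) :
    taylor M s = 1 / (mT s : ℚ≥0) := by
  rw [one_div]
  exact TCrig_eq_inv_mRig M _ hs
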